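/- If α is a Young function satisfying the Δ₂-condition, then r_α := inf_{x>0} x·α'₋(x)/α(x) ≥ 1 and 1 < p_α := sup_{x>0} x·α'₊(x)/α(x) < +∞, where α'₋ and α'₊ denote the left and right derivatives of α. -/

import Mathlib

open MeasureTheory Filter Set Topology
open scoped ENNReal NNReal

noncomputable section

/-- The right derivative of a function `α : ℝ → ℝ`. -/
def rightD (α : ℝ → ℝ) (x : ℝ) : ℝ := derivWithin α (Set.Ioi x) x

/-- The left derivative of a function `α : ℝ → ℝ`. -/
def leftD (α : ℝ → ℝ) (x : ℝ) : ℝ := derivWithin α (Set.Iio x) x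

/-- A Young function: an even, convex, nonnegative function, increasing on `[0,∞)`,
vanishing at `0` and with vanishing right derivative at `0`. -/
structure IsYoung (α : ℝ → ℝ) : Prop where
  nonneg : ∀ x, 0 ≤ α x
  even : ∀ x, α (-x) = α x
  convex : ConvexOn ℝ Set.univ α
  mono : StrictMonoOn α (Set.Ici 0)
  zero : α 0 = 0
  rightD_zero : rightD α 0 = 0

/-- The Δ₂-condition for a Young function. -/
def DeltaTwo (α : ℝ → ℝ) : Prop := ∃ K > 0, ∀ x : ℝ, α (2 * x) ≤ K * α x

/-- `r_α = inf_{x>0} x α'₋(x)/α(x)`. -/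
def rAlpha (α : ℝ → ℝ) : ℝ := sInf {r : ℝ | ∃ x > 0, r = x * leftD α x / α x}

/-- `p_α = sup_{x>0} x α'₊(x)/α(x)`. -/
def pAlpha (α : ℝ → ℝ) : ℝ := sSup {r : ℝ | ∃ x > 0, r = x * rightD α x / α x}

/-- The Fenchel-Legendre transform `α*(y) = sup_x {xy - α(x)}`, with values in `[0,∞]`. -/
def legendre (α : ℝ → ℝ) (y : ℝ) : ℝ≥0∞ := ⨆ x : ℝ, ENNReal.ofReal (x * y - α x)

/-- `ξ_α(t) = sup_{u>0} α*(t α'₊(u)) / (t α(u))`. -/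
def xiAlpha (α : ℝ → ℝ) (t : ℝ) : ℝ≥0∞ :=
  ⨆ u : {u : ℝ // 0 < u}, legendre α (t * rightD α u) / ENNReal.ofReal (t * α u)

/-- A bounded real-valued function. -/
def IsBoundedFun {Y : Type*} (f : Y → ℝ) : Prop := ∃ M, ∀ x, |f x| ≤ M

variable {X : Type*} [MetricSpace X] [MeasurableSpace X]

/-- The optimal transport cost `T_α(ν,μ)` between two measures, for the cost
function `(x,y) ↦ α(d(x,y))`. -/
def transportCost (α : ℝ → ℝ) (ν μ : Measure X) : ℝ≥0∞ :=
  sInf { c : ℝ≥0∞ | ∃ π : Measure (X × X), π.map Prod.fst = ν ∧ π.map Prod.snd = μ ∧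
      c = ∫⁻ z, ENNReal.ofReal (α (dist z.1 z.2)) ∂π }

open Classical in
/-- The relative entropy `H(ν|μ) = ∫ log (dν/dμ) dν` if `ν ≪ μ` (and `+∞` if `ν` is not
absolutely continuous with respect to `μ`, or if the integral diverges). -/
def relEnt (ν μ : Measure X) : ℝ≥0∞ :=
  if ν ≪ μ ∧ Integrable (fun x => Real.log (ν.rnDeriv μ x).toReal) ν
  then ENNReal.ofReal (∫ x, Real.log (ν.rnDeriv μ x).toReal ∂ν) else ⊤

/-- The transport-entropy inequality `T_α(C)`: for every probability measure `ν`,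
`T_α(ν,μ) ≤ C H(ν|μ)`. -/
def TransportEntropy (μ : Measure X) (α : ℝ → ℝ) (C : ℝ) : Prop :=
  ∀ ν : Measure X, IsProbabilityMeasure ν →
    transportCost α ν μ ≤ ENNReal.ofReal C * relEnt ν μ

/-- The entropy functional `Ent_μ(e^f)`. -/
def entExp (μ : Measure X) (f : X → ℝ) : ℝ :=
  ∫ x, Real.exp (f x) * Real.log (Real.exp (f x)) ∂μ
    - (∫ x, Real.exp (f x) ∂μ) * Real.log (∫ x, Real.exp (f x) ∂μ)

/-- `|∇⁺ f|(x) = limsup_{y → x} [f(y) - f(x)]₊ / d(y,x)` (equal to `0` at isolated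
points by the conventions on `limsup` and `sInf` in `ℝ`). -/
def gradPlus (f : X → ℝ) (x : X) : ℝ :=
  limsup (fun y => max (f y - f x) 0 / dist y x) (𝓝[≠] x)

/-- `|∇⁻ f|(x) = limsup_{y → x} [f(y) - f(x)]₋ / d(y,x)` (equal to `0` at isolated
points by the conventions on `limsup` and `sInf` in `ℝ`). -/
def gradMinus (f : X → ℝ) (x : X) : ℝ :=
  limsup (fun y => max (-(f y - f x)) 0 / dist y x) (𝓝[≠] x)

/-- The modified log-Sobolev inequality plus `LSI⁺_α(A)`. -/
def LSIplus (μ : Measure X) (α : ℝ → ℝ) (A : ℝ) : Prop :=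
  ∀ f : X → ℝ, IsBoundedFun f → LocallyLipschitz f →
    ENNReal.ofReal (entExp μ f) ≤
      ENNReal.ofReal A * ∫⁻ x, legendre α (gradPlus f x) * ENNReal.ofReal (Real.exp (f x)) ∂μ

/-- The modified log-Sobolev inequality minus `LSI⁻_α(A)`. -/
def LSIminus (μ : Measure X) (α : ℝ → ℝ) (A : ℝ) : Prop :=
  ∀ f : X → ℝ, IsBoundedFun f → LocallyLipschitz f →
    ENNReal.ofReal (entExp μ f) ≤
      ENNReal.ofReal A * ∫⁻ x, legendre α (gradMinus f x) * ENNReal.ofReal (Real.exp (f x)) ∂μ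

/-- The inf-convolution operator `Q_α^λ f(x) = inf_y {f(y) + λ α(d(x,y))}`. -/
def QInf (α : ℝ → ℝ) (lam : ℝ) (f : X → ℝ) (x : X) : ℝ :=
  ⨅ y : X, (f y + lam * α (dist x y))

/-- The `(τ)`-log-Sobolev inequality `(τ)-LSI_α(λ, A)`. -/
def TauLSI (μ : Measure X) (α : ℝ → ℝ) (lam A : ℝ) : Prop :=
  ∀ f : X → ℝ, IsBoundedFun f → LocallyLipschitz f →
    entExp μ f ≤ A * ∫ x, (f x - QInf α lam f x) * Real.exp (f x) ∂μ

/-- The `n`-dimensional inf-convolution operator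
`Q_{α,n} f(x) = inf_y {f(y) + Σᵢ α(d(xᵢ,yᵢ))}`. -/
def QInfN (α : ℝ → ℝ) {n : ℕ} (f : (Fin n → X) → ℝ) (x : Fin n → X) : ℝ :=
  ⨅ y : Fin n → X, (f y + ∑ i, α (dist (x i) (y i)))

/-- The `n`-dimensional sup-convolution operator
`P_{α,n} f(x) = sup_y {f(y) - Σᵢ α(d(xᵢ,yᵢ))}`. -/
def PSupN (α : ℝ → ℝ) {n : ℕ} (f : (Fin n → X) → ℝ) (x : Fin n → X) : ℝ :=
  ⨆ y : Fin n → X, (f y - ∑ i, α (dist (x i) (y i)))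

end


namespace IsYoung

variable {α : ℝ → ℝ} {x y : ℝ}

theorem pos (hα : IsYoung α) (hx : 0 < x) : 0 < α x := by
  simpa [hα.zero] using hα.mono Set.self_mem_Ici hx.le hx

theorem slope_le_leftD (hα : IsYoung α) (hyx : y < x) : slope α y x ≤ leftD α x :=
  hα.convex.slope_le_leftDeriv_of_mem_interior (mem_univ _) (by simp) hyx

theorem slope_le_rightD (hα : IsYoung α) (hyx : y < x) : slope α y x ≤ rightD α x :=
  (hα.slope_le_leftD hyx).trans (hα.convex.leftDeriv_le_rightDeriv_of_mem_interior (by simp))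

theorem rightD_le_slope (hα : IsYoung α) (hxy : x < y) : rightD α x ≤ slope α x y :=
  hα.convex.rightDeriv_le_slope_of_mem_interior (by simp) (mem_univ _) hxy

theorem one_le_mul_leftD_div (hα : IsYoung α) (hx : 0 < x) : 1 ≤ x * leftD α x / α x := by
  have h := hα.slope_le_leftD hx
  rw [slope_def_field, hα.zero, sub_zero, sub_zero, div_le_iff₀ hx] at h
  rw [one_le_div (hα.pos hx)]
  linarith

theorem mul_rightD_div_le (hα : IsYoung α) {K : ℝ} (hK : ∀ x, α (2 * x) ≤ K * α x)
    (hx : 0 < x) : x * rightD α x / α x ≤ K - 1 := by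
  have h := hα.rightD_le_slope (show x < 2 * x by linarith)
  rw [slope_def_field, le_div_iff₀ (by linarith)] at h
  rw [div_le_iff₀ (hα.pos hx)]
  linarith [hK x]

/-- Since `α'₊(0) = 0`, the chord of `α` over `[0, x]` lies strictly above `α` at some point. -/
theorem exists_lt_mul_div (hα : IsYoung α) (hx : 0 < x) :
    ∃ y, 0 < y ∧ y < x ∧ α y < y * (α x / x) := by
  have hd : HasDerivWithinAt α 0 (Ioi 0) 0 := by
    have h := hα.convex.hasDerivWithinAt_rightDeriv_of_mem_interior (x := 0) (by simp)
    rwa [show derivWithin α (Ioi 0) 0 = 0 from hα.rightD_zero] at h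
  rw [hasDerivWithinAt_iff_tendsto_slope' (by simp)] at hd
  obtain ⟨y, hlt, hy0, hyx⟩ := ((hd.eventually_lt_const (div_pos (hα.pos hx) hx)).and
    (Ioo_mem_nhdsGT hx)).exists
  refine ⟨y, hy0, hyx, ?_⟩
  rw [slope_def_field, hα.zero, sub_zero, sub_zero, div_lt_iff₀ hy0] at hlt
  linarith

theorem one_lt_mul_rightD_div (hα : IsYoung α) (hx : 0 < x) : 1 < x * rightD α x / α x := by
  obtain ⟨y, hy0, hyx, hy⟩ := hα.exists_lt_mul_div hx
  have h := hα.slope_le_rightD hyx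
  rw [slope_def_field, div_le_iff₀ (sub_pos.2 hyx)] at h
  rw [one_lt_div (hα.pos hx), ← div_lt_iff₀' hx]
  have hx' : α x / x * x = α x := div_mul_cancel₀ _ hx.ne'
  refine lt_of_mul_lt_mul_right ?_ (sub_pos.2 hyx).le
  linarith

end IsYoung

theorem young_delta_two_exponents (α : ℝ → ℝ) (hα : IsYoung α) (hΔ : DeltaTwo α) :
    1 ≤ rAlpha α ∧ 1 < pAlpha α ∧
      BddAbove {r : ℝ | ∃ x > 0, r = x * rightD α x / α x} := by
  obtain ⟨K, -, hK⟩ := hΔ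
  have hbdd : BddAbove {r : ℝ | ∃ x > 0, r = x * rightD α x / α x} := by
    refine ⟨K - 1, ?_⟩
    rintro _ ⟨x, hx, rfl⟩
    exact hα.mul_rightD_div_le hK hx
  refine ⟨le_csInf ⟨_, 1, one_pos, rfl⟩ ?_, ?_, hbdd⟩
  · rintro _ ⟨x, hx, rfl⟩
    exact hα.one_le_mul_leftD_div hx
  · exact (hα.one_lt_mul_rightD_div one_pos).trans_le (le_csSup hbdd ⟨1, one_pos, rfl⟩)
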